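/- Let p be an odd prime and F: V → F_{p^m} a vectorial dual-bent function satisfying Condition II. Let χ_1 be the canonical additive character of V and a ∈ V \ {0}. Then T' := Σ_{x ∈ V, F(x)=0} χ_1(ax) equals 0 if F^*(a) = 0, equals (1/p^m) υ p^{n/2} (−1)^{m−1} ϵ^m √(p^m) if F^*(a) is a nonzero square in F_{p^m}, and equals −(1/p^m) υ p^{n/2} (−1)^{m−1} ϵ^m √(p^m) if F^*(a) is a nonsquare. -/

import Mathlib

open Complex Finset

/-- `ζ_p^k` for `k ∈ Z/p`. -/
noncomputable def zetaP (p : ℕ) (k : ZMod p) : ℂ :=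
  Complex.exp (2 * Real.pi * Complex.I * (k.val : ℂ) / p)

/-- `ϵ = sqrt((-1)^{(p-1)/2})`: equal to `1` if `p ≡ 1 (mod 4)` and `i`
otherwise. -/
noncomputable def epsC (p : ℕ) : ℂ := if p % 4 = 1 then 1 else Complex.I

theorem prod_range_two_mul_of_reflect_neg {R : Type*} [CommRing R] (r : ℕ) (f : ℕ → R)
    (h : ∀ k < r, f (2 * r - 1 - k) = -f k) :
    ∏ k ∈ range (2 * r), f k = (-1) ^ r * (∏ k ∈ range r, f k) ^ 2 := by
  have h2 : ∏ k ∈ range r, f (r + k) = ∏ k ∈ range r, -f k := by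
    rw [← prod_range_reflect]
    refine prod_congr rfl fun k hk => ?_
    rw [mem_range] at hk
    rw [← h k hk]
    congr 1
    omega
  rw [two_mul, prod_range_add, h2, prod_neg, card_range]
  ring

theorem IsPrimitiveRoot.sq_prod_pow_sub_pow {R : Type*} [CommRing R] [IsDomain R] {r : ℕ} {ω : R}
    (hω : IsPrimitiveRoot ω (2 * r + 1)) :
    (∏ k ∈ range r, (ω ^ (k + 1) - ω ^ (2 * r - k))) ^ 2 = (-1) ^ r * (2 * r + 1) := by
  have hsum : ∑ k ∈ range (2 * r), (k + 1) = (2 * r + 1) * r := by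
    have := Finset.sum_range_id_mul_two (2 * r + 1)
    rw [sum_range_succ'] at this
    simp only [add_tsub_cancel_right] at this
    linarith
  have hpow : ∏ k ∈ range (2 * r), ω ^ (2 * r - k) = 1 := by
    rw [← prod_range_reflect]
    calc _ = ∏ k ∈ range (2 * r), ω ^ (k + 1) := prod_congr rfl fun k hk => by
            rw [mem_range] at hk
            congr 1
            omega
      _ = 1 := by rw [prod_pow_eq_pow_sum, hsum, pow_mul, hω.pow_eq_one, one_pow]
  have hsq : IsPrimitiveRoot (ω ^ 2) (2 * r + 1) := hω.pow_of_coprime 2 (by simp)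
  have hprod := hsq.prod_one_sub_pow_eq_order
  have hall : ∏ k ∈ range (2 * r), (ω ^ (k + 1) - ω ^ (2 * r - k)) = 2 * r + 1 := by
    calc _ = ∏ k ∈ range (2 * r), (-1 * ω ^ (2 * r - k) * (1 - (ω ^ 2) ^ (k + 1))) :=
          prod_congr rfl fun k hk => by
            rw [mem_range] at hk
            have : ω ^ (2 * r - k) * (ω ^ 2) ^ (k + 1) = ω ^ (k + 1) := by
              rw [← pow_mul, ← pow_add, show 2 * r - k + 2 * (k + 1) = (2 * r + 1) + (k + 1) by omega,
                pow_add, hω.pow_eq_one, one_mul]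
            linear_combination -this
      _ = _ := by
        rw [prod_mul_distrib, prod_mul_distrib, hpow, hprod]
        simp
  rw [prod_range_two_mul_of_reflect_neg] at hall
  · rw [← hall, ← mul_assoc, ← mul_pow]
    simp
  · intro k hk
    rw [show 2 * r - 1 - k + 1 = 2 * r - k by omega, show 2 * r - (2 * r - 1 - k) = k + 1 by omega]
    ring

theorem ZMod.sq_factorial_half {r : ℕ} [Fact (2 * r + 1).Prime] :
    ((r.factorial : ZMod (2 * r + 1))) ^ 2 = -(-1) ^ r := by
  have h := prod_range_two_mul_of_reflect_neg r (fun k => ((k + 1 : ℕ) : ZMod (2 * r + 1))) (by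
    intro k hk
    rw [eq_neg_iff_add_eq_zero, ← Nat.cast_add,
      show 2 * r - 1 - k + 1 + (k + 1) = 2 * r + 1 by omega, CharP.cast_eq_zero])
  rw [← Nat.cast_prod, ← Nat.cast_prod, prod_range_add_one_eq_factorial,
    prod_range_add_one_eq_factorial] at h
  have hw := ZMod.wilsons_lemma (2 * r + 1)
  rw [add_tsub_cancel_right, h] at hw
  have h1 : ((-1 : ZMod (2 * r + 1)) ^ r) * (-1) ^ r = 1 := by rw [← mul_pow]; simp
  linear_combination (-1) ^ r * hw - (r.factorial : ZMod (2 * r + 1)) ^ 2 * h1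

open Polynomial in
/-- The coefficient of `(X - 1) ^ r` in `∑ j, j ^ r X ^ (2 j)` over `ZMod (2 r + 1)`. -/
theorem ZMod.sum_pow_mul_choose {r : ℕ} [Fact (2 * r + 1).Prime] :
    (r.factorial : ZMod (2 * r + 1)) *
      ∑ j : ZMod (2 * r + 1), j ^ r * ((2 * j.val).choose r : ZMod (2 * r + 1)) = -2 ^ r := by
  have hr : 0 < r := by
    rcases Nat.eq_zero_or_pos r with rfl | h
    · exact absurd (Fact.out : (2 * 0 + 1).Prime) (by norm_num)
    · exact h
  have key : ∀ j : ZMod (2 * r + 1), (r.factorial : ZMod (2 * r + 1)) *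
      ((2 * j.val).choose r : ZMod (2 * r + 1)) =
      ∑ i ∈ range (r + 1), (descPochhammer (ZMod (2 * r + 1)) r).coeff i * (2 * j) ^ i := by
    intro j
    rw [← Nat.cast_mul, ← Nat.descFactorial_eq_factorial_mul_choose,
      ← descPochhammer_eval_eq_descFactorial, eval_eq_sum_range, descPochhammer_natDegree]
    simp
  rw [mul_sum]
  calc _ = ∑ j : ZMod (2 * r + 1), ∑ i ∈ range (r + 1),
        (descPochhammer (ZMod (2 * r + 1)) r).coeff i * 2 ^ i * j ^ (r + i) := by
        refine sum_congr rfl fun j _ => ?_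
        rw [mul_left_comm, key, mul_sum]
        refine sum_congr rfl fun i _ => ?_
        ring
    _ = ∑ i ∈ range (r + 1), (descPochhammer (ZMod (2 * r + 1)) r).coeff i * 2 ^ i *
          ∑ j : ZMod (2 * r + 1), j ^ (r + i) := by
        rw [sum_comm]
        simp_rw [mul_sum]
    _ = _ := by
        rw [sum_range_succ, sum_eq_zero, zero_add]
        · have hlead : (descPochhammer (ZMod (2 * r + 1)) r).coeff r = 1 := by
            have := (monic_descPochhammer (ZMod (2 * r + 1)) r).coeff_natDegree
            rwa [descPochhammer_natDegree] at this
          have hs : ∑ j : ZMod (2 * r + 1), j ^ (r + r) = -1 := by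
            have h1 : ∀ j : ZMod (2 * r + 1), j ^ (r + r) = 1 - if j = 0 then 1 else 0 := by
              intro j
              split_ifs with hj
              · rw [hj, zero_pow (by omega), sub_self]
              · have := ZMod.pow_card_sub_one_eq_one hj
                rw [sub_zero, ← this]
                congr 1
                omega
            rw [sum_congr rfl fun j _ => h1 j, sum_sub_distrib, sum_ite_eq' univ 0]
            rw [sum_const, card_univ, ZMod.card, nsmul_one, CharP.cast_eq_zero]
            simp
          rw [hlead, hs]
          ring
        · intro i hi
          rw [mem_range] at hi
          rw [FiniteField.sum_pow_lt_card_sub_one, mul_zero]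
          rw [ZMod.card]
          omega

open Polynomial in
/-- The sign in `∑ j, χ j ω ^ (2 j) = ± ∏ k, (ω ^ k - ω ^ (-k))` modulo `p`. -/
theorem IsPrimitiveRoot.sign_of_quadratic_gaussSum {r : ℕ} [Fact (2 * r + 1).Prime] {ω : ℂ}
    (hω : IsPrimitiveRoot ω (2 * r + 1)) (e : ℤ)
    (h : ∑ j : ZMod (2 * r + 1), (quadraticChar (ZMod (2 * r + 1)) j : ℂ) * ω ^ (2 * j.val) =
      e * ∏ k ∈ range r, (ω ^ (k + 1) - ω ^ (2 * r - k))) :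
    (e : ZMod (2 * r + 1)) = (-1) ^ r := by
  have hr : 0 < r := by
    rcases Nat.eq_zero_or_pos r with rfl | h
    · exact absurd (Fact.out : (2 * 0 + 1).Prime) (by norm_num)
    · exact h
  set A : ℤ[X] := ∑ j : ZMod (2 * r + 1), C (quadraticChar (ZMod (2 * r + 1)) j) * X ^ (2 * j.val)
    with hA
  set D : ℤ[X] := ∏ k ∈ range r, (X ^ (k + 1) - X ^ (2 * r - k)) with hD
  have hdvd : cyclotomic (2 * r + 1) ℤ ∣ A - C e * D := by
    rw [cyclotomic_eq_minpoly hω (by omega)]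
    refine minpoly.isIntegrallyClosed_dvd (hω.isIntegral (by omega)) ?_
    simp [hA, hD, h, -quadraticChar_apply]
  have hdvd' : ((X : (ZMod (2 * r + 1))[X]) - 1) ^ (2 * r) ∣
      (A - C e * D).map (Int.castRingHom (ZMod (2 * r + 1))) := by
    have h1 := Polynomial.map_dvd (Int.castRingHom (ZMod (2 * r + 1))) hdvd
    rw [map_cyclotomic] at h1
    have h2 := cyclotomic_mul_prime_eq_pow_of_not_dvd (ZMod (2 * r + 1)) (p := 2 * r + 1) (n := 1)
      (by rw [Nat.dvd_one]; omega)
    rw [one_mul, cyclotomic_one, add_tsub_cancel_right] at h2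
    rwa [h2] at h1
  have hcoeff : (taylor 1 ((A - C e * D).map (Int.castRingHom (ZMod (2 * r + 1))))).coeff r = 0 := by
    obtain ⟨Q, hQ⟩ := hdvd'
    rw [hQ, taylor_mul, taylor_pow]
    have : taylor 1 ((X : (ZMod (2 * r + 1))[X]) - 1) = X := by simp
    rw [this, coeff_X_pow_mul', if_neg (by omega)]
  have hcA : (taylor 1 (A.map (Int.castRingHom (ZMod (2 * r + 1))))).coeff r =
      ∑ j : ZMod (2 * r + 1), j ^ r * ((2 * j.val).choose r : ZMod (2 * r + 1)) := by
    rw [hA, Polynomial.map_sum, map_sum, finsetSum_coeff]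
    refine sum_congr rfl fun j _ => ?_
    rw [Polynomial.map_mul, Polynomial.map_pow, map_X, map_C, taylor_mul, taylor_C, taylor_pow,
      taylor_X, coeff_C_mul, C_1, coeff_X_add_one_pow, eq_intCast,
      quadraticChar_eq_pow_of_char_ne_two' (by rw [ZMod.ringChar_zmod_n]; omega), ZMod.card,
      show (2 * r + 1) / 2 = r by omega]
  have hcD : (taylor 1 (D.map (Int.castRingHom (ZMod (2 * r + 1))))).coeff r =
      2 ^ r * r.factorial := by
    have hq : ∀ k ∈ range r, ∃ q : (ZMod (2 * r + 1))[X],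
        X ^ (k + 1) - X ^ (2 * r - k) = (X - 1) * q ∧ q.eval 1 = 2 * ((k + 1 : ℕ) : ZMod (2 * r + 1)) := by
      intro k hk
      rw [mem_range] at hk
      have : (X - C 1 : (ZMod (2 * r + 1))[X]) ∣ X ^ (k + 1) - X ^ (2 * r - k) := by
        rw [dvd_iff_isRoot]
        simp
      obtain ⟨q, hq⟩ := this
      rw [C_1] at hq
      refine ⟨q, hq, ?_⟩
      have h1 := congrArg (fun f => (derivative f).eval 1) hq
      simp only [derivative_sub, derivative_X_pow, derivative_mul, eval_sub, eval_mul, eval_add,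
        derivative_X, derivative_one, eval_X, eval_one, eval_pow, eval_C, one_pow, sub_self,
        zero_mul, add_zero, mul_one, sub_zero, one_mul] at h1
      rw [← h1]
      have h2 : ((2 * r - k : ℕ) : ZMod (2 * r + 1)) + ((k + 1 : ℕ) : ZMod (2 * r + 1)) = 0 := by
        rw [← Nat.cast_add, show 2 * r - k + (k + 1) = 2 * r + 1 by omega, CharP.cast_eq_zero]
      linear_combination -h2
    choose! q hq1 hq2 using hq
    have hDmap : D.map (Int.castRingHom (ZMod (2 * r + 1))) =
        (X - 1) ^ r * ∏ k ∈ range r, q k := by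
      rw [hD, Polynomial.map_prod]
      simp only [Polynomial.map_sub, Polynomial.map_pow, map_X]
      rw [prod_congr rfl hq1, prod_mul_distrib, prod_const, card_range]
    have hX : taylor 1 ((X : (ZMod (2 * r + 1))[X]) - 1) = X := by simp
    rw [hDmap, taylor_mul, taylor_pow, hX, coeff_X_pow_mul', if_pos le_rfl, Nat.sub_self,
      taylor_coeff_zero, eval_prod, prod_congr rfl hq2, prod_mul_distrib, prod_const, card_range,
      ← Nat.cast_prod, prod_range_add_one_eq_factorial]
  rw [Polynomial.map_sub, Polynomial.map_mul, map_C, map_sub, taylor_mul, taylor_C, coeff_sub,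
    coeff_C_mul, hcA, hcD, sub_eq_zero, eq_intCast] at hcoeff
  have hsum := ZMod.sum_pow_mul_choose (r := r)
  rw [hcoeff] at hsum
  have h2 : (2 : ZMod (2 * r + 1)) ^ r ≠ 0 := by
    refine pow_ne_zero _ fun h2 => ?_
    have : ((2 : ℕ) : ZMod (2 * r + 1)) = 0 := by exact_mod_cast h2
    rw [ZMod.natCast_eq_zero_iff] at this
    have := Nat.le_of_dvd (by norm_num) this
    omega
  have hf := ZMod.sq_factorial_half (r := r)
  have h1 : ((-1 : ZMod (2 * r + 1)) ^ r) * (-1) ^ r = 1 := by rw [← mul_pow]; simp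
  have h3 : (2 : ZMod (2 * r + 1)) ^ r * (e * (-1) ^ r - 1) = 0 := by
    linear_combination -hsum + e * 2 ^ r * hf
  have h4 := (mul_eq_zero.1 h3).resolve_left h2
  linear_combination (-1) ^ r * h4 - e * h1

theorem stdAddChar_eq_exp_pow {r : ℕ} [Fact (2 * r + 1).Prime] (j : ZMod (2 * r + 1)) :
    ZMod.stdAddChar j = (-Complex.exp (Real.pi * I / (2 * r + 1 : ℕ))) ^ (2 * j.val) := by
  rw [pow_mul, neg_sq, ← pow_mul, ← Complex.exp_nat_mul, ZMod.stdAddChar_apply, ZMod.toCircle_apply]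
  congr 1
  push_cast
  ring

theorem isPrimitiveRoot_neg_exp (r : ℕ) :
    IsPrimitiveRoot (-Complex.exp (Real.pi * I / (2 * r + 1 : ℕ))) (2 * r + 1) := by
  have h := Complex.isPrimitiveRoot_exp (2 * r + 1) (by omega)
  have h2 := h.pow_of_coprime (r + 1) (by
    rw [Nat.coprime_comm, show 2 * r + 1 = r + (r + 1) by omega]; simp)
  convert h2 using 1
  rw [← Complex.exp_nat_mul, ← neg_one_mul, ← Complex.exp_pi_mul_I, ← Complex.exp_add]
  congr 1
  have : ((2 * r + 1 : ℕ) : ℂ) ≠ 0 := by exact_mod_cast (by omega : 2 * r + 1 ≠ 0)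
  field_simp
  push_cast
  ring

theorem neg_exp_pow_sub_pow (r k : ℕ) (hk : k < r) :
    (-Complex.exp (Real.pi * I / (2 * r + 1 : ℕ))) ^ (k + 1) -
      (-Complex.exp (Real.pi * I / (2 * r + 1 : ℕ))) ^ (2 * r - k) =
    -(I * (-1) ^ k) * ((2 * Real.sin (Real.pi * (k + 1) / (2 * r + 1)) : ℝ) : ℂ) := by
  have h0 : (2 * (r : ℂ) + 1) ≠ 0 := by exact_mod_cast (by omega : 2 * r + 1 ≠ 0)
  have h1 : Complex.exp (Real.pi * I / (2 * r + 1 : ℕ)) ^ (2 * r - k) =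
      -Complex.exp (-(Real.pi * (k + 1) / (2 * r + 1)) * I) := by
    rw [← neg_one_mul, ← Complex.exp_pi_mul_I, ← Complex.exp_nat_mul, ← Complex.exp_add]
    congr 1
    rw [Nat.cast_sub (by omega)]
    push_cast
    field_simp
    ring
  have h2 : Complex.exp (Real.pi * I / (2 * r + 1 : ℕ)) ^ (k + 1) =
      Complex.exp ((Real.pi * (k + 1) / (2 * r + 1)) * I) := by
    rw [← Complex.exp_nat_mul]
    congr 1
    push_cast
    ring
  have h3 : (-1 : ℂ) ^ (2 * r - k) = (-1) ^ k := by
    have : (-1 : ℂ) ^ (2 * r - k) * (-1) ^ k = 1 := by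
      rw [← pow_add, show 2 * r - k + k = 2 * r by omega]; simp
    have h4 : ((-1 : ℂ) ^ k) * (-1) ^ k = 1 := by rw [← mul_pow]; simp
    linear_combination (-1) ^ k * this - (-1) ^ (2 * r - k) * h4
  rw [neg_pow, neg_pow (Complex.exp _) (2 * r - k), h1, h2, h3]
  push_cast
  rw [Complex.sin, pow_succ]
  linear_combination (-(-1) ^ k * (Complex.exp ((Real.pi * (k + 1) / (2 * r + 1)) * I) -
    Complex.exp (-(Real.pi * (k + 1) / (2 * r + 1)) * I))) * I_sq

theorem prod_I_mul_neg_one_pow (r : ℕ) :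
    ∏ k ∈ range r, (I * (-1) ^ k) = if Even r then 1 else I := by
  induction r with
  | zero => simp
  | succ r ih =>
    rw [prod_range_succ, ih]
    rcases Nat.even_or_odd r with h | h
    · simp [h, h.neg_one_pow, Nat.even_add_one]
    · simp [Nat.not_even_iff_odd.2 h, h.neg_one_pow, Nat.even_add_one]

theorem Int.eq_of_cast_zmod_eq {p : ℕ} (hp : 2 < p) {a b : ℤ} (ha : a = 1 ∨ a = -1)
    (hb : b = 1 ∨ b = -1) (h : (a : ZMod p) = b) : a = b := by
  have : Fact (2 < p) := ⟨hp⟩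
  have h1 := ZMod.neg_one_ne_one (n := p)
  rcases ha with rfl | rfl <;> rcases hb with rfl | rfl <;> push_cast at h
  · rfl
  · exact absurd h.symm h1
  · exact absurd h h1
  · rfl

theorem quadratic_gaussSum_sq (p : ℕ) [Fact p.Prime] (hp : p ≠ 2) :
    (∑ j : ZMod p, (quadraticChar (ZMod p) j : ℂ) * ZMod.stdAddChar j) ^ 2 =
      (-1) ^ (p / 2) * p := by
  have hchar : ringChar (ZMod p) ≠ 2 := by rwa [ZMod.ringChar_zmod_n]
  have hodd := (Fact.out : p.Prime).eq_two_or_odd.resolve_left hp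
  have h := gaussSum_sq (χ := (quadraticChar (ZMod p)).ringHomComp (Int.castRingHom ℂ))
    ((MulChar.ringHomComp_ne_one_iff Int.cast_injective).2 (quadraticChar_ne_one hchar))
    ((quadraticChar_isQuadratic _).comp _) (ZMod.isPrimitive_stdAddChar p)
  simp only [gaussSum, MulChar.ringHomComp_apply, eq_intCast] at h
  rw [h, quadraticChar_neg_one hchar, ZMod.card, ZMod.χ₄_eq_neg_one_pow hodd]
  push_cast
  rfl

/-- Gauss's determination of the quadratic Gauss sum. -/
theorem quadratic_gaussSum_eq (p : ℕ) [Fact p.Prime] (hp : p ≠ 2) :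
    ∑ j : ZMod p, (quadraticChar (ZMod p) j : ℂ) * ZMod.stdAddChar j =
      epsC p * (Real.sqrt p : ℂ) := by
  have hsq := quadratic_gaussSum_sq p hp
  have hodd := (Fact.out : p.Prime).eq_two_or_odd.resolve_left hp
  obtain ⟨r, rfl⟩ : ∃ r, p = 2 * r + 1 := ⟨p / 2, by omega⟩
  have hr : 0 < r := by
    rcases Nat.eq_zero_or_pos r with rfl | h
    · exact absurd (Fact.out : (2 * 0 + 1).Prime) (by norm_num)
    · exact h
  rw [show (2 * r + 1) / 2 = r by omega] at hsq
  set g := ∑ j : ZMod (2 * r + 1), (quadraticChar (ZMod (2 * r + 1)) j : ℂ) * ZMod.stdAddChar j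
    with hg
  set ω : ℂ := -Complex.exp (Real.pi * I / (2 * r + 1 : ℕ)) with hωdef
  have hω : IsPrimitiveRoot ω (2 * r + 1) := isPrimitiveRoot_neg_exp r
  have hP := hω.sq_prod_pow_sub_pow
  set P := ∏ k ∈ range r, (ω ^ (k + 1) - ω ^ (2 * r - k)) with hPdef
  have hgω : g = ∑ j : ZMod (2 * r + 1),
      (quadraticChar (ZMod (2 * r + 1)) j : ℂ) * ω ^ (2 * j.val) :=
    sum_congr rfl fun j _ => by rw [stdAddChar_eq_exp_pow]
  obtain ⟨e, he, hge⟩ : ∃ e : ℤ, (e = 1 ∨ e = -1) ∧ g = e * P := by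
    have : g ^ 2 = P ^ 2 := by
      rw [hsq, hP]
      push_cast
      rfl
    rcases sq_eq_sq_iff_eq_or_eq_neg.1 this with h | h
    · exact ⟨1, Or.inl rfl, by rw [h]; simp⟩
    · exact ⟨-1, Or.inr rfl, by rw [h]; simp⟩
  have hesign : e = (-1) ^ r := by
    refine Int.eq_of_cast_zmod_eq (p := 2 * r + 1) (by omega) he (neg_one_pow_eq_or ℤ r) ?_
    rw [hω.sign_of_quadratic_gaussSum e (hgω ▸ hge)]
    push_cast
    rfl
  set S : ℝ := ∏ k ∈ range r, 2 * Real.sin (Real.pi * (k + 1) / (2 * r + 1)) with hS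
  have hSpos : 0 < S := by
    refine prod_pos fun k hk => mul_pos two_pos (Real.sin_pos_of_pos_of_lt_pi ?_ ?_)
    · have := Real.pi_pos
      positivity
    · rw [mem_range] at hk
      rw [div_lt_iff₀ (by positivity)]
      have : (k : ℝ) + 1 ≤ r := by exact_mod_cast hk
      have hr' : (0 : ℝ) < r := by exact_mod_cast hr
      have := Real.pi_pos
      nlinarith
  have hgS : g = (if Even r then 1 else I) * S := by
    rw [hge, hesign, hPdef, prod_congr rfl fun k hk => neg_exp_pow_sub_pow r k (mem_range.1 hk),
      prod_mul_distrib, prod_neg, card_range, prod_I_mul_neg_one_pow, hS, Complex.ofReal_prod]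
    have h1 : ((-1 : ℂ) ^ r) * (-1) ^ r = 1 := by rw [← mul_pow]; simp
    push_cast
    rw [← mul_assoc, ← mul_assoc, h1, one_mul]
  have hSsq : S ^ 2 = (2 * r + 1 : ℕ) := by
    have : (S : ℂ) ^ 2 = (2 * r + 1 : ℕ) := by
      rw [hgS, mul_pow] at hsq
      rcases Nat.even_or_odd r with h | h
      · simpa [h, h.neg_one_pow] using hsq
      · rw [if_neg (Nat.not_even_iff_odd.2 h), I_sq, h.neg_one_pow] at hsq
        linear_combination -hsq
    exact_mod_cast this
  rw [hgS, ← hSsq, Real.sqrt_sq hSpos.le, epsC]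
  congr 2
  rw [Nat.even_iff, eq_iff_iff]
  omega

section QuadraticGaussSum

variable {K : Type*} [Field K] [Fintype K] [DecidableEq K]

theorem sum_addChar_sq (hK : ringChar K ≠ 2) {ψ : AddChar K ℂ} (hψ : ψ ≠ 1) :
    ∑ x, ψ (x ^ 2) = ∑ x, (quadraticChar K x : ℂ) * ψ x := by
  have h0 := AddChar.sum_eq_zero_of_ne_one hψ
  calc ∑ x, ψ (x ^ 2) = ∑ c, ∑ x with x ^ 2 = c, ψ (x ^ 2) :=
        (sum_fiberwise univ (fun x : K => x ^ 2) _).symm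
    _ = ∑ c, ((quadraticChar K c : ℂ) + 1) * ψ c := by
        refine sum_congr rfl fun c _ => ?_
        rw [sum_congr rfl (g := fun _ => ψ c) fun x hx => by rw [(mem_filter.1 hx).2], sum_const,
          nsmul_eq_mul]
        have := quadraticChar_card_sqrts hK c
        rw [Set.toFinset_ofPred] at this
        congr 1
        exact_mod_cast this
    _ = _ := by
        simp_rw [add_mul, one_mul]
        rw [sum_add_distrib, h0, add_zero]

theorem sum_quadraticChar_mul_addChar_mul (hK : ringChar K ≠ 2) (ψ : AddChar K ℂ) (b : K) :
    ∑ x, (quadraticChar K x : ℂ) * ψ (x * b) =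
      quadraticChar K b * ∑ x, (quadraticChar K x : ℂ) * ψ x := by
  rcases eq_or_ne b 0 with rfl | hb
  · simp only [mul_zero, AddChar.map_zero_eq_one, mul_one, MulChar.map_zero, Int.cast_zero, zero_mul]
    exact_mod_cast quadraticChar_sum_zero hK
  · rw [mul_sum]
    refine Fintype.sum_equiv (Equiv.mulRight₀ b hb) _ _ fun x => ?_
    have h1 : ((quadraticChar K b : ℤ) : ℂ) ^ 2 = 1 := by exact_mod_cast quadraticChar_sq_one hb
    rw [Equiv.mulRight₀_apply, map_mul (quadraticChar K)]
    push_cast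
    linear_combination -(quadraticChar K x : ℂ) * ψ (x * b) * h1

end QuadraticGaussSum

theorem sum_addChar_mul_sq {K : Type*} [Field K] [Fintype K] [DecidableEq K] (hK : ringChar K ≠ 2)
    {ψ : AddChar K ℂ} (hψ : ψ.IsPrimitive) {b : K} (hb : b ≠ 0) :
    ∑ x, ψ (b * x ^ 2) = quadraticChar K b * ∑ x, (quadraticChar K x : ℂ) * ψ x := by
  rw [← sum_quadraticChar_mul_addChar_mul hK]
  simpa [AddChar.mulShift_apply, mul_comm b] using sum_addChar_sq hK (hψ hb)

theorem quadraticChar_discr {p : ℕ} [Fact p.Prime] (hp : p ≠ 2) {K : Type*} [Field K] [Fintype K]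
    [Algebra (ZMod p) K] {m : ℕ} (v : Module.Basis (Fin m) (ZMod p) K) :
    quadraticChar (ZMod p) (Algebra.discr (ZMod p) v) = (-1) ^ (m - 1) := by
  have hodd := (Fact.out : p.Prime).eq_two_or_odd.resolve_left hp
  have hp2 : 2 < p := lt_of_le_of_ne (Fact.out : p.Prime).two_le hp.symm
  have hdisc : Algebra.discr (ZMod p) v ≠ 0 := Algebra.discr_not_zero_of_basis _ _
  have : CharP K p := charP_of_injective_algebraMap (algebraMap (ZMod p) K).injective p
  have hm : Module.finrank (ZMod p) K = m := by
    rw [Module.finrank_eq_card_basis v, Fintype.card_fin]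
  have hcard : Fintype.card K = p ^ m := by
    rw [Module.card_eq_pow_finrank (K := ZMod p), ZMod.card, hm]
  have hmpos : 0 < m := hm ▸ Module.finrank_pos
  let M : Matrix (Fin m) (Fin m) K := Matrix.of fun i j => v j ^ p ^ (i : ℕ)
  have hsq : algebraMap (ZMod p) K (Algebra.discr (ZMod p) v) = M.det ^ 2 := by
    rw [Algebra.discr_def, RingHom.map_det, sq]
    nth_rw 1 [← Matrix.det_transpose M]
    rw [← Matrix.det_mul]
    congr 1
    ext i j
    rw [RingHom.mapMatrix_apply, Matrix.map_apply, Algebra.traceMatrix_apply,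
      Algebra.traceForm_apply, FiniteField.algebraMap_trace_eq_sum_pow, hm, Finset.sum_range,
      Matrix.mul_apply]
    refine sum_congr rfl fun k _ => ?_
    rw [Nat.card_zmod, mul_pow]
    rfl
  have hfrob : M.det ^ p = (-1) ^ (m - 1) * M.det := by
    rw [← frobenius_def, RingHom.map_det]
    have : (frobenius K p).mapMatrix M = M.submatrix (finRotate m) id := by
      ext i j
      obtain ⟨k, hk⟩ : ∃ k, m = k + 1 := ⟨m - 1, by omega⟩
      rw [RingHom.mapMatrix_apply, Matrix.map_apply, frobenius_def, Matrix.submatrix_apply]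
      change (v j ^ p ^ (i : ℕ)) ^ p = v j ^ p ^ ((finRotate m i : Fin m) : ℕ)
      rw [← pow_mul, ← pow_succ]
      by_cases hi : (i : ℕ) + 1 = m
      · have h0 : ((finRotate m i : Fin m) : ℕ) = 0 := by
          subst hk
          rw [coe_finRotate, if_pos (Fin.ext (by simpa using hi))]
        rw [hi, h0, ← hcard, FiniteField.pow_card, pow_zero, pow_one]
      · have h0 : ((finRotate m i : Fin m) : ℕ) = i + 1 := by
          subst hk
          rw [coe_finRotate, if_neg fun h => hi (by rw [h]; simp)]
        rw [h0]
    rw [this, Matrix.det_permute, sign_finRotate]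
    push_cast
    rfl
  have hdet : M.det ≠ 0 := by
    intro h
    rw [h, zero_pow two_ne_zero, map_eq_zero] at hsq
    exact hdisc hsq
  have hpow : M.det ^ (2 * (p / 2)) = (-1) ^ (m - 1) := by
    apply mul_right_cancel₀ hdet
    rw [← hfrob, ← pow_succ]
    congr 1
    omega
  refine Int.eq_of_cast_zmod_eq hp2 (quadraticChar_dichotomy hdisc) (neg_one_pow_eq_or ℤ _) ?_
  rw [quadraticChar_eq_pow_of_char_ne_two' (by rwa [ZMod.ringChar_zmod_n]), ZMod.card]
  apply (algebraMap (ZMod p) K).injective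
  rw [map_pow, hsq, ← pow_mul, hpow]
  simp

theorem trace_addChar_ne_one (p : ℕ) [Fact p.Prime] (K : Type*) [Field K] [Finite K]
    [Algebra (ZMod p) K] :
    (ZMod.stdAddChar (N := p)).compAddMonoidHom (Algebra.trace (ZMod p) K).toAddMonoidHom ≠ 1 := by
  obtain ⟨x, hx⟩ := Algebra.trace_surjective (ZMod p) K 1
  refine AddChar.ne_one_iff.2 ⟨x, fun h => ?_⟩
  change ZMod.stdAddChar (Algebra.trace (ZMod p) K x) = 1 at h
  rw [hx, ← AddChar.map_zero_eq_one (ZMod.stdAddChar (N := p))] at h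
  exact one_ne_zero (ZMod.injective_stdAddChar h)

theorem AddChar.map_finsetSum {ι A M : Type*} [AddCommMonoid A] [CommMonoid M] (ψ : AddChar A M)
    (s : Finset ι) (f : ι → A) : ψ (∑ i ∈ s, f i) = ∏ i ∈ s, ψ (f i) := by
  classical
  induction s using Finset.induction_on with
  | empty => simp
  | insert i s hi ih => rw [sum_insert hi, prod_insert hi, AddChar.map_add_eq_mul, ih]

/-- The Hasse–Davenport relation for the quadratic character of `K` over its prime field. -/
theorem quadratic_gaussSum_trace {p : ℕ} [Fact p.Prime] (hp : p ≠ 2) {K : Type*} [Field K]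
    [Fintype K] [DecidableEq K] [Algebra (ZMod p) K] :
    ∑ x : K, (quadraticChar K x : ℂ) * ZMod.stdAddChar (Algebra.trace (ZMod p) K x) =
      (-1) ^ (Module.finrank (ZMod p) K - 1) *
        (∑ j : ZMod p, (quadraticChar (ZMod p) j : ℂ) * ZMod.stdAddChar j) ^
          Module.finrank (ZMod p) K := by
  have hcharp : ringChar (ZMod p) ≠ 2 := by rwa [ZMod.ringChar_zmod_n]
  have : CharP K p := charP_of_injective_algebraMap (algebraMap (ZMod p) K).injective p
  have hchar : ringChar K ≠ 2 := by rwa [ringChar.eq K p]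
  have : Invertible (2 : ZMod p) := invertibleOfNonzero (Ring.two_ne_zero hcharp)
  have hsymm : (Algebra.traceForm (ZMod p) K).IsSymm := Algebra.traceForm_isSymm _
  obtain ⟨v, hv⟩ := LinearMap.BilinForm.exists_orthogonal_basis
    (LinearMap.BilinForm.isSymm_iff.1 hsymm)
  set a : Fin (Module.finrank (ZMod p) K) → ZMod p :=
    fun i => Algebra.trace (ZMod p) K (v i * v i) with ha
  have horth : ∀ i j, i ≠ j → Algebra.trace (ZMod p) K (v i * v j) = 0 := fun i j hij => hv hij
  have hdiscr : Algebra.discr (ZMod p) v = ∏ i, a i := by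
    rw [Algebra.discr_def, ← Matrix.det_diagonal]
    congr 1
    ext i j
    rw [Algebra.traceMatrix_apply, Algebra.traceForm_apply, Matrix.diagonal_apply]
    split_ifs with h
    · rw [h]
    · exact horth i j h
  have ha0 : ∀ i, a i ≠ 0 := by
    have := Algebra.discr_not_zero_of_basis (ZMod p) v
    rw [hdiscr, prod_ne_zero_iff] at this
    exact fun i => this i (mem_univ i)
  let ψ : AddChar K ℂ :=
    (ZMod.stdAddChar (N := p)).compAddMonoidHom (Algebra.trace (ZMod p) K).toAddMonoidHom
  have hψ : ψ ≠ 1 := trace_addChar_ne_one p K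
  have htr : ∀ t : Fin (Module.finrank (ZMod p) K) → ZMod p,
      Algebra.trace (ZMod p) K ((v.equivFun.symm t) ^ 2) = ∑ i, a i * t i ^ 2 := by
    intro t
    rw [Module.Basis.equivFun_symm_apply, sq, sum_mul_sum, map_sum]
    refine sum_congr rfl fun i _ => ?_
    rw [map_sum, sum_eq_single i]
    · rw [smul_mul_smul_comm, map_smul, smul_eq_mul]
      ring
    · intro j _ hj
      rw [smul_mul_smul_comm, map_smul, horth i j hj.symm, smul_zero]
    · simp
  calc _ = ∑ x : K, ψ (x ^ 2) := (sum_addChar_sq hchar hψ).symm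
    _ = ∑ t : Fin (Module.finrank (ZMod p) K) → ZMod p,
          ∏ i, ZMod.stdAddChar (a i * t i ^ 2) := by
        refine Fintype.sum_equiv v.equivFun.toEquiv _ _ fun x => ?_
        rw [← AddChar.map_finsetSum, LinearEquiv.coe_toEquiv, ← htr, LinearEquiv.symm_apply_apply]
        rfl
    _ = ∏ i, ∑ t : ZMod p, ZMod.stdAddChar (a i * t ^ 2) := by
        rw [prod_univ_sum, Fintype.piFinset_univ]
    _ = _ := by
        rw [prod_congr rfl fun i _ =>
            sum_addChar_mul_sq hcharp (ZMod.isPrimitive_stdAddChar p) (ha0 i),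
          prod_mul_distrib, prod_const, card_univ, Fintype.card_fin, ← Int.cast_prod, ← map_prod,
          ← hdiscr, quadraticChar_discr hp]
        push_cast
        rfl

theorem zetaP_eq_stdAddChar (p : ℕ) [NeZero p] (k : ZMod p) : zetaP p k = ZMod.stdAddChar k := by
  rw [zetaP, ZMod.stdAddChar_apply, ZMod.toCircle_apply]

/-- Odd powers prime to the order of the unit group preserve quadratic Gauss sums. -/
theorem sum_quadraticChar_mul_zpow {K : Type*} [Field K] [Fintype K] [DecidableEq K]
    {d : ℕ} (hd : 2 ≤ d) (hdeven : Even d) (hgcd : Nat.gcd (d - 1) (Fintype.card K - 1) = 1)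
    (f : K → ℂ) :
    ∑ c ∈ univ.erase (0 : K), (quadraticChar K c : ℂ) * f (c ^ ((1 : ℤ) - d)) =
      ∑ c, (quadraticChar K c : ℂ) * f c := by
  have hrhs : ∑ c, (quadraticChar K c : ℂ) * f c =
      ∑ c ∈ univ.erase (0 : K), (quadraticChar K c : ℂ) * f c := by
    rw [← add_sum_erase univ _ (mem_univ 0)]
    simp
  have hunits : ∀ g : K → ℂ, ∑ c ∈ univ.erase (0 : K), g c = ∑ u : Kˣ, g u := fun g =>
    (sum_nbij (fun u : Kˣ => (u : K)) (by simp) (fun _ _ _ _ h => Units.ext h)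
      (fun c hc => ⟨Units.mk0 c (by simpa using hc), by simp⟩) fun _ _ => rfl).symm
  rw [hrhs, hunits, hunits]
  have hcop : (Nat.card Kˣ).Coprime (d - 1) := by
    rw [Nat.card_eq_fintype_card, Fintype.card_units, Nat.coprime_comm]
    exact hgcd
  refine Fintype.sum_equiv ((powCoprime hcop).trans (Equiv.inv Kˣ)) _ _ fun u => ?_
  have hval : (((powCoprime hcop).trans (Equiv.inv Kˣ) u : Kˣ) : K) = (u : K) ^ ((1 : ℤ) - d) := by
    rw [Equiv.trans_apply, powCoprime_apply, Equiv.inv_apply, Units.val_inv_eq_inv_val,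
      Units.val_pow_eq_pow_val, ← zpow_natCast, ← zpow_neg, Nat.cast_sub (by omega)]
    congr 1
    push_cast
    ring
  have hchi : quadraticChar K (((powCoprime hcop).trans (Equiv.inv Kˣ) u : Kˣ) : K) =
      quadraticChar K (u : K) := by
    have hodd : Odd (d - 1) := Nat.Even.sub_odd (by omega) hdeven odd_one
    have h1 : quadraticChar K (u : K) ^ (d - 1) = quadraticChar K (u : K) := by
      rcases quadraticChar_dichotomy u.ne_zero with h | h <;> rw [h]
      · simp
      · exact hodd.neg_one_pow
    have h2 : quadraticChar K (((u ^ (d - 1))⁻¹ : Kˣ) : K) *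
        quadraticChar K ((u ^ (d - 1) : Kˣ) : K) = 1 := by
      rw [← map_mul, ← Units.val_mul, inv_mul_cancel]
      simp
    rw [Units.val_pow_eq_pow_val, map_pow, h1] at h2
    have h3 := quadraticChar_sq_one u.ne_zero
    rw [Equiv.trans_apply, powCoprime_apply, Equiv.inv_apply]
    linear_combination quadraticChar K (u : K) * h2 -
      quadraticChar K (((u ^ (d - 1))⁻¹ : Kˣ) : K) * h3
  rw [hchi, hval]

/-- Under Condition II, for `a ≠ 0` the sum `T' = Σ_{x ∈ V, F(x)=0} χ_1(ax)`
equals `0` if `F^*(a) = 0`, `(1/p^m) υ p^{n/2} (-1)^{m-1} ϵ^m √(p^m)` if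
`F^*(a)` is a nonzero square, and the negative of that if `F^*(a)` is a
nonsquare. -/
theorem sum_over_zeros_condII
    (p n m d : ℕ) [Fact p.Prime] (hp : p ≠ 2)
    (hm : 1 ≤ m) (hmn : m ≤ n) (hnm : Even (n - m)) (hn3m : 3 * m ≤ n)
    (V : Type*) [AddCommGroup V] [Module (ZMod p) V] [Fintype V]
    (hV : Fintype.card V = p ^ n)
    (K : Type*) [Field K] [Fintype K] [DecidableEq K] [Algebra (ZMod p) K]
    (hK : Fintype.card K = p ^ m)
    (B : V →ₗ[ZMod p] V →ₗ[ZMod p] ZMod p)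
    (hBsym : ∀ v w, B v w = B w v)
    (hBnd : ∀ v, (∀ w, B v w = 0) → v = 0)
    (F Fstar : V → K)
    (υ : ℂ) (hυ : υ = epsC p ^ m ∨ υ = -(epsC p ^ m))
    (hd : 2 ≤ d) (hdeven : Even d)
    (hgcd : Nat.gcd (d - 1) (p ^ m - 1) = 1)
    (hF0 : F 0 = 0) (hFstar0 : Fstar 0 = 0)
    (hFstarneg : ∀ a : V, Fstar (-a) = Fstar a)
    (hWalsh : ∀ c : K, c ≠ 0 → ∀ a : V,
      ∑ x : V, zetaP p (Algebra.trace (ZMod p) K (c * F x) - B a x)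
        = υ * (quadraticChar K c : ℂ) * (Real.sqrt ((p : ℝ) ^ n) : ℂ)
            * zetaP p (Algebra.trace (ZMod p) K (c ^ ((1 : ℤ) - d) * Fstar a)))
    (a : V) (ha : a ≠ 0) :
    (Fstar a = 0 →
      ∑ x ∈ Finset.univ.filter (fun x : V => F x = 0), zetaP p (B a x) = 0)
    ∧ (Fstar a ≠ 0 → IsSquare (Fstar a) →
      ∑ x ∈ Finset.univ.filter (fun x : V => F x = 0), zetaP p (B a x)
        = ((1 : ℂ) / (p : ℂ) ^ m) * υ * (Real.sqrt ((p : ℝ) ^ n) : ℂ)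
            * (-1) ^ (m - 1) * epsC p ^ m * (Real.sqrt ((p : ℝ) ^ m) : ℂ))
    ∧ (¬ IsSquare (Fstar a) →
      ∑ x ∈ Finset.univ.filter (fun x : V => F x = 0), zetaP p (B a x)
        = -(((1 : ℂ) / (p : ℂ) ^ m) * υ * (Real.sqrt ((p : ℝ) ^ n) : ℂ)
            * (-1) ^ (m - 1) * epsC p ^ m * (Real.sqrt ((p : ℝ) ^ m) : ℂ))) := by
  classical
  have hpp : p.Prime := Fact.out
  have hcharp : CharP K p := charP_of_injective_algebraMap (algebraMap (ZMod p) K).injective p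
  have hchar : ringChar K ≠ 2 := by rwa [ringChar.eq K p]
  have hfinrank : Module.finrank (ZMod p) K = m := by
    have h := Module.card_eq_pow_finrank (K := ZMod p) (V := K)
    rw [hK, ZMod.card] at h
    exact (Nat.pow_right_injective hpp.two_le h).symm
  let ψ : AddChar K ℂ :=
    (ZMod.stdAddChar (N := p)).compAddMonoidHom (Algebra.trace (ZMod p) K).toAddMonoidHom
  have hψ1 : ψ ≠ 1 := trace_addChar_ne_one p K
  have hψ : ψ.IsPrimitive := AddChar.IsPrimitive.of_ne_one hψ1
  have hψapply : ∀ x, ψ x = ZMod.stdAddChar (Algebra.trace (ZMod p) K x) := fun _ => rfl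
  have hG : ∑ x : K, (quadraticChar K x : ℂ) * ψ x =
      (-1) ^ (m - 1) * epsC p ^ m * (Real.sqrt ((p : ℝ) ^ m) : ℂ) := by
    have hsqrt : Real.sqrt p ^ m = Real.sqrt ((p : ℝ) ^ m) := by
      rw [← Real.sqrt_sq (pow_nonneg (Real.sqrt_nonneg p) m), ← pow_mul, mul_comm, pow_mul,
        Real.sq_sqrt p.cast_nonneg]
    have h := quadratic_gaussSum_trace hp (K := K)
    rw [hfinrank, quadratic_gaussSum_eq p hp, mul_pow, ← Complex.ofReal_pow, hsqrt] at h
    rw [mul_assoc, ← h]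
    rfl
  have hB0 : ∑ x : V, ZMod.stdAddChar (B a x) = 0 := by
    have hne : (ZMod.stdAddChar (N := p)).compAddMonoidHom (B a).toAddMonoidHom ≠ 1 := by
      intro h
      refine ha (hBnd a fun w => ZMod.injective_stdAddChar ?_)
      rw [AddChar.map_zero_eq_one]
      exact DFunLike.congr_fun h w
    exact AddChar.sum_eq_zero_of_ne_one hne
  simp only [zetaP_eq_stdAddChar] at hWalsh ⊢
  have hcard : (p : ℂ) ^ m * ∑ x ∈ univ.filter (fun x : V => F x = 0), ZMod.stdAddChar (B a x) =
      υ * (Real.sqrt ((p : ℝ) ^ n) : ℂ) * (quadraticChar K (Fstar a) *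
        ((-1) ^ (m - 1) * epsC p ^ m * (Real.sqrt ((p : ℝ) ^ m) : ℂ))) := by
    calc _ = ∑ x : V, ZMod.stdAddChar (B a x) * ∑ c : K, ψ (c * F x) := by
          rw [sum_filter, mul_sum]
          refine sum_congr rfl fun x _ => ?_
          rw [AddChar.sum_mulShift _ hψ, hK]
          split_ifs <;> push_cast <;> ring
      _ = ∑ c : K, ∑ x : V, ZMod.stdAddChar (Algebra.trace (ZMod p) K (c * F x) - B (-a) x) := by
          simp_rw [mul_sum]
          rw [sum_comm]
          refine sum_congr rfl fun c _ => sum_congr rfl fun x _ => ?_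
          rw [hψapply, ← AddChar.map_add_eq_mul, map_neg, LinearMap.neg_apply, sub_neg_eq_add,
            add_comm]
      _ = ∑ c ∈ univ.erase (0 : K), ∑ x : V,
            ZMod.stdAddChar (Algebra.trace (ZMod p) K (c * F x) - B (-a) x) := by
          rw [← add_sum_erase univ _ (mem_univ 0)]
          simp [hB0]
      _ = υ * (Real.sqrt ((p : ℝ) ^ n) : ℂ) * ∑ c ∈ univ.erase (0 : K),
            (quadraticChar K c : ℂ) * ψ (c ^ ((1 : ℤ) - d) * Fstar a) := by
          rw [mul_sum]
          refine sum_congr rfl fun c hc => ?_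
          rw [hWalsh c (ne_of_mem_erase hc), hFstarneg, hψapply]
          ring
      _ = _ := by
          rw [sum_quadraticChar_mul_zpow hd hdeven (by rwa [hK]) fun c => ψ (c * Fstar a),
            sum_quadraticChar_mul_addChar_mul hchar, hG]
  have hp0 : (p : ℂ) ^ m ≠ 0 := pow_ne_zero _ (Nat.cast_ne_zero.2 hpp.ne_zero)
  refine ⟨fun h => ?_, fun h hsq => ?_, fun hsq => ?_⟩ <;> apply mul_left_cancel₀ hp0 <;> rw [hcard]
  · rw [h, MulChar.map_zero]
    simp
  · rw [(quadraticChar_one_iff_isSquare h).2 hsq]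
    field_simp
    push_cast
    ring
  · rw [quadraticChar_neg_one_iff_not_isSquare.2 hsq]
    field_simp
    push_cast
    ring
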